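/- For integers 0 ≤ k ≤ n, the convex hull in the real vector space of n×n real symmetric matrices of the set G_k(ℝ^n) = {A symmetric : A² = A, tr A = k} equals H_k(ℝ^n) = {A symmetric : A is positive semidefinite, I_n − A is positive semidefinite, tr A = k}. -/

import Mathlib

/-- A point of the hypersimplex with two distinct fractional coordinates can be moved along the
difference of the corresponding basis vectors until it has fewer fractional coordinates. -/
theorem exists_pos_shift_mem_hypersimplex {ι : Type*} [Fintype ι] [DecidableEq ι] (c : ℝ)
    (v : ι → ℝ) (hv : ∀ i, 0 ≤ v i ∧ v i ≤ 1) (hs : ∑ i, v i = c) (i j : ι) (hij : i ≠ j)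
    (hi : v i ≠ 0 ∧ v i ≠ 1) (hj : v j ≠ 0 ∧ v j ≠ 1) :
    ∃ s : ℝ, 0 < s ∧ ∃ w : ι → ℝ, w = v + s • (Pi.single i 1 - Pi.single j 1) ∧
      (∀ l, 0 ≤ w l ∧ w l ≤ 1) ∧ ∑ l, w l = c ∧
      (Finset.univ.filter fun l => w l ≠ 0 ∧ w l ≠ 1).card <
        (Finset.univ.filter fun l => v l ≠ 0 ∧ v l ≠ 1).card := by
  have hi1 : v i < 1 := lt_of_le_of_ne (hv i).2 hi.2
  have hj0 : 0 < v j := lt_of_le_of_ne (hv j).1 hj.1.symm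
  have hpos : 0 < min (1 - v i) (v j) := lt_min (by linarith) hj0
  refine ⟨min (1 - v i) (v j), hpos, _, rfl, ?_, ?_, ?_⟩
  all_goals
    have hsi := min_le_left (1 - v i) (v j)
    have hsj := min_le_right (1 - v i) (v j)
    have hcase := min_choice (1 - v i) (v j)
    generalize min (1 - v i) (v j) = s at *
  · intro l
    have hl := hv l
    have hi' := hv i
    by_cases h1 : l = i
    · subst h1
      simp [hij]
      constructor <;> linarith
    · by_cases h2 : l = j
      · subst h2
        simp [h1]
        constructor <;> linarith
      · simpa [h1, h2] using hl
  · simp [Finset.sum_add_distrib, ← Finset.mul_sum, hs]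
  · apply Finset.card_lt_card
    rw [Finset.ssubset_iff_of_subset]
    · rcases hcase with h | h
      · exact ⟨i, by simpa using hi, by simp [hij, h]⟩
      · exact ⟨j, by simpa using hj, by simp [hij.symm, h]⟩
    · intro l
      by_cases h1 : l = i
      · subst h1; simp [hi.1, hi.2]
      · by_cases h2 : l = j
        · subst h2; simp [hj.1, hj.2]
        · simp [h1, h2]

/-- A vector in the unit cube with integral coordinate sum has no, or at least two, fractional
coordinates. -/
theorem exists_ne_fractional {ι : Type*} [Fintype ι] [DecidableEq ι] (k : ℕ) (v : ι → ℝ)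
    (hv : ∀ i, 0 ≤ v i ∧ v i ≤ 1) (hs : ∑ i, v i = k) (i : ι) (hi : v i ≠ 0 ∧ v i ≠ 1) :
    ∃ j, i ≠ j ∧ v j ≠ 0 ∧ v j ≠ 1 := by
  by_contra! h
  have hz : ∃ m : ℤ, ∑ j ∈ Finset.univ.erase i, v j = m := by
    refine ⟨∑ j ∈ Finset.univ.erase i, if v j = 0 then 0 else 1, ?_⟩
    push_cast
    refine Finset.sum_congr rfl fun j hj => ?_
    split_ifs with h0
    · exact h0
    · exact h j (Finset.ne_of_mem_erase hj).symm h0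
  obtain ⟨m, hm⟩ := hz
  have hsum := Finset.add_sum_erase Finset.univ v (Finset.mem_univ i)
  have hi0 : 0 < v i := lt_of_le_of_ne (hv i).1 hi.1.symm
  have hi1 : v i < 1 := lt_of_le_of_ne (hv i).2 hi.2
  have h0 : (0 : ℝ) < ((k - m : ℤ) : ℝ) := by push_cast; linarith
  have h1 : ((k - m : ℤ) : ℝ) < 1 := by push_cast; linarith
  have h0' : (0 : ℤ) < k - m := by exact_mod_cast h0
  have h1' : (k - m : ℤ) < 1 := by exact_mod_cast h1
  omega

/-- The hypersimplex is contained in the convex hull of its `0`/`1` points. -/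
theorem mem_convexHull_zero_one_of_sum_eq {ι : Type*} [Fintype ι] [DecidableEq ι] (k : ℕ)
    (v : ι → ℝ) (hv : ∀ i, 0 ≤ v i ∧ v i ≤ 1) (hs : ∑ i, v i = k) :
    v ∈ convexHull ℝ {w : ι → ℝ | (∀ i, w i = 0 ∨ w i = 1) ∧ ∑ i, w i = k} := by
  induction hN : (Finset.univ.filter fun l => v l ≠ 0 ∧ v l ≠ 1).card using
    Nat.strong_induction_on generalizing v with
  | _ N ih =>
    subst hN
    by_cases hfrac : ∃ i, v i ≠ 0 ∧ v i ≠ 1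
    · obtain ⟨i, hi⟩ := hfrac
      obtain ⟨j, hij, hj⟩ := exists_ne_fractional k v hv hs i hi
      obtain ⟨s, hs0, w, hw, hw01, hws, hwc⟩ :=
        exists_pos_shift_mem_hypersimplex k v hv hs i j hij hi hj
      obtain ⟨t, ht0, u, hu, hu01, hus, huc⟩ :=
        exists_pos_shift_mem_hypersimplex k v hv hs j i hij.symm hj hi
      have hw' := ih _ hwc w hw01 hws rfl
      have hu' := ih _ huc u hu01 hus rfl
      have hst : s + t ≠ 0 := by positivity
      have hcomb : v = (t / (s + t)) • w + (s / (s + t)) • u := by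
        rw [hw, hu]
        ext l
        simp only [Pi.add_apply, Pi.smul_apply, Pi.sub_apply, smul_eq_mul]
        field_simp
        ring
      rw [hcomb]
      exact convex_convexHull ℝ _ hw' hu' (by positivity) (by positivity)
        (by field_simp; ring)
    · push Not at hfrac
      exact subset_convexHull ℝ _ ⟨fun i => or_iff_not_imp_left.2 (hfrac i), hs⟩

/-- A real symmetric idempotent matrix is positive semidefinite. -/
theorem Matrix.IsSymm.posSemidef_of_mul_self {m : Type*} [Fintype m] {A : Matrix m m ℝ}
    (hA : A.IsSymm) (h : A * A = A) : A.PosSemidef := by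
  have := Matrix.posSemidef_conjTranspose_mul_self A
  rwa [Matrix.conjTranspose_eq_transpose_of_trivial, hA.eq, h] at this

/-- Conjugation of diagonal matrices, as a linear map in the diagonal entries. -/
noncomputable def conjDiagonal {m : Type*} [Fintype m] [DecidableEq m] (U : Matrix m m ℝ) :
    (m → ℝ) →ₗ[ℝ] Matrix m m ℝ :=
  LinearMap.mulRight ℝ (star U) ∘ₗ LinearMap.mulLeft ℝ U ∘ₗ Matrix.diagonalLinearMap m ℝ ℝ

theorem conjDiagonal_apply {m : Type*} [Fintype m] [DecidableEq m] (U : Matrix m m ℝ)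
    (v : m → ℝ) : conjDiagonal U v = U * Matrix.diagonal v * star U := rfl

/-- Fillmore–Williams (real case): the convex hull (over ℝ) of the real Grassmannian
`G_k(ℝ^n)`, realized as the set of symmetric projections of trace `k`, is the set
of symmetric matrices `A` with `A ⪰ 0`, `I - A ⪰ 0` and `tr A = k`. -/
theorem convexHull_grassmannian_real (n k : ℕ) (hk : k ≤ n) :
    convexHull ℝ
        {A : Matrix (Fin n) (Fin n) ℝ | A.IsSymm ∧ A * A = A ∧ A.trace = (k : ℝ)} =
      {A : Matrix (Fin n) (Fin n) ℝ |
        A.IsSymm ∧ A.PosSemidef ∧ (1 - A).PosSemidef ∧ A.trace = (k : ℝ)} := by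
  apply Set.Subset.antisymm
  · apply convexHull_min
    · rintro A ⟨hA, hAA, ht⟩
      refine ⟨hA, hA.posSemidef_of_mul_self hAA, ?_, ht⟩
      exact (Matrix.isSymm_one.sub hA).posSemidef_of_mul_self (by
        rw [sub_mul, one_mul, mul_sub, mul_one, hAA, sub_self, sub_zero])
    · rintro A ⟨hA, hA0, hA1, hAt⟩ B ⟨hB, hB0, hB1, hBt⟩ a b ha hb hab
      refine ⟨(hA.smul a).add (hB.smul b), (hA0.smul ha).add (hB0.smul hb), ?_, ?_⟩
      · have : 1 - (a • A + b • B) = a • (1 - A) + b • (1 - B) := by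
          rw [smul_sub, smul_sub, sub_add_sub_comm, ← add_smul, hab, one_smul]
        rw [this]
        exact (hA1.smul ha).add (hB1.smul hb)
      · rw [Matrix.trace_add, Matrix.trace_smul, Matrix.trace_smul, hAt, hBt, ← add_smul, hab,
          one_smul]
  · rintro A ⟨-, hA0, hA1, hAt⟩
    have hH := hA0.isHermitian
    set U : Matrix (Fin n) (Fin n) ℝ := hH.eigenvectorUnitary.1
    have hUU : star U * U = 1 := Unitary.coe_star_mul_self hH.eigenvectorUnitary
    have hspec : A = conjDiagonal U hH.eigenvalues := hH.spectral_theorem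
    have hle : ∀ i, hH.eigenvalues i ≤ 1 := by
      intro i
      have hdiag : star U * (1 - A) * U = 1 - Matrix.diagonal hH.eigenvalues := by
        rw [mul_sub, sub_mul, mul_one, hUU]
        conv_lhs => rw [hspec, conjDiagonal_apply]
        rw [← mul_assoc, ← mul_assoc, hUU, one_mul, mul_assoc, hUU, mul_one]
      have hp : (star U * (1 - A) * U).PosSemidef := hA1.conjTranspose_mul_mul_same U
      rw [hdiag] at hp
      have := hp.diag_nonneg (i := i)
      simpa using this
    have hsum : ∑ i, hH.eigenvalues i = k := by
      rw [← hAt, hH.trace_eq_sum_eigenvalues]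
      rfl
    have hmem := mem_convexHull_zero_one_of_sum_eq k hH.eigenvalues
      (fun i => ⟨hA0.eigenvalues_nonneg i, hle i⟩) hsum
    have himg := Set.mem_image_of_mem (conjDiagonal U) hmem
    rw [← hspec, LinearMap.image_convexHull] at himg
    refine convexHull_mono ?_ himg
    rintro _ ⟨w, ⟨hw, hws⟩, rfl⟩
    rw [conjDiagonal_apply]
    refine ⟨?_, ?_, ?_⟩
    · rw [Matrix.IsSymm, Matrix.star_eq_conjTranspose,
        Matrix.conjTranspose_eq_transpose_of_trivial]
      simp [Matrix.transpose_mul, mul_assoc]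
    · have hww : Matrix.diagonal w * Matrix.diagonal w = Matrix.diagonal w := by
        rw [Matrix.diagonal_mul_diagonal]
        congr 1
        ext i
        rcases hw i with h | h <;> simp [h]
      calc U * Matrix.diagonal w * star U * (U * Matrix.diagonal w * star U)
          = U * Matrix.diagonal w * (star U * U) * Matrix.diagonal w * star U := by
            simp only [mul_assoc]
        _ = U * Matrix.diagonal w * star U := by
            rw [hUU, mul_one, mul_assoc U, hww]
    · rw [Matrix.trace_mul_comm, ← mul_assoc, hUU, one_mul, Matrix.trace_diagonal, hws]
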